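/- arXiv:2603.19813 — 2 statements merged into one kernel-verified Lean document; each statement's English description precedes it below -/
import Mathlib

section
/- If λ ∈ ℂ and φ ∈ C(K,ℂ) with φ not identically zero satisfy T_ℂ φ = λ·φ and |λ| = r, where r is the spectral radius of T, then λ = r and there exists a complex number z with |z| = 1 such that φ(x) = z·|φ(x)| for every x ∈ K. -/
open MeasureTheory

/-- The Lebesgue measure on `ℝ^d` restricted to (i.e., viewed on) the subset `K`. -/
noncomputable def lebOn {d : ℕ} (K : Set (EuclideanSpace ℝ (Fin d))) : Measure ↥K :=
  Measure.comap Subtype.val volume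

theorem aux_cont {E : Type*} [NormedAddCommGroup E] [NormedSpace ℝ E] [CompleteSpace E]
    (T : E →L[ℝ] E) {s : ℝ} (hs : s ∈ resolventSet ℝ T) : ContinuousAt (resolvent T) s := 
  (spectrum.hasDerivAt_resolvent_const_left hs).continuousAt

theorem aux_limit {E : Type*} [NormedAddCommGroup E] [NormedSpace ℝ E]
    (ν : ℕ → E →L[ℝ] ℝ) (h : ∀ n f, |ν n f| ≤ ‖f‖) :
    ∃ μ : E →L[ℝ] ℝ, ∀ f, Filter.Tendsto (fun n => ν n f)
      ((Filter.hyperfilter ℕ : Ultrafilter ℕ) : Filter ℕ) (nhds (μ f)) := by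
  have hcomp := WeakDual.isCompact_closedBall (0 : E →L[ℝ] ℝ) 1
  let w : ℕ → WeakDual ℝ E := fun n => StrongDual.toWeakDual (ν n)
  obtain ⟨μ, -, hμ⟩ := hcomp.ultrafilter_le_nhds ((Filter.hyperfilter ℕ).map w) (by
    rw [Filter.le_principal_iff]
    refine Filter.Eventually.of_forall (f := ((Filter.hyperfilter ℕ : Ultrafilter ℕ) : Filter ℕ))
      fun n => ?_
    show (ν n) ∈ Metric.closedBall (0 : E →L[ℝ] ℝ) 1
    refine mem_closedBall_zero_iff.2 ((ν n).opNorm_le_bound zero_le_one fun f => ?_)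
    simpa using h n f)
  refine ⟨WeakDual.toStrongDual μ, fun f => ?_⟩
  exact ((WeakDual.eval_continuous f).tendsto μ).comp hμ

theorem aux_contr {X : Type*} [TopologicalSpace X] [CompactSpace X] [Nonempty X]
    (A : C(X, ℝ) →L[ℝ] C(X, ℝ)) (hA : ∀ f, 0 ≤ f → 0 ≤ A f) (hn : ‖A 1‖ < 1)
    (g : C(X, ℝ)) (hg : A g ≤ g) : 0 ≤ g := by
  obtain ⟨x0, -, hx0⟩ := isCompact_univ.exists_isMinOn Set.univ_nonempty g.continuous.continuousOn
  have hmin : ∀ x, g x0 ≤ g x := fun x => hx0 (Set.mem_univ x)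
  by_contra hneg
  have hlt : g x0 < 0 := by
    by_contra h
    exact hneg fun x => (not_lt.1 h).trans (hmin x)
  have h1 : 0 ≤ A (g - g x0 • (1 : C(X, ℝ))) := by
    apply hA
    intro x
    simpa using hmin x
  have h2 := ContinuousMap.le_def.1 h1 x0
  have h3 := ContinuousMap.le_def.1 hg x0
  have h4 : (A 1) x0 ≤ ‖A 1‖ := (le_abs_self _).trans ((A 1).norm_coe_le_norm x0)
  simp only [map_sub, map_smul, ContinuousMap.zero_apply, ContinuousMap.sub_apply,
    ContinuousMap.smul_apply, smul_eq_mul] at h2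
  nlinarith

theorem aux_radius_ne_top {X : Type*} [TopologicalSpace X] [CompactSpace X] [Nonempty X]
    (T : C(X, ℝ) →L[ℝ] C(X, ℝ)) : spectralRadius ℝ T ≠ ⊤ := by
  have := spectrum.spectralRadius_le_nnnorm (𝕜 := ℝ) T
  exact ne_top_of_le_ne_top ENNReal.coe_ne_top this

theorem aux_resolvent {X : Type*} [TopologicalSpace X] [CompactSpace X] [Nonempty X]
    (T : C(X, ℝ) →L[ℝ] C(X, ℝ)) {s : ℝ} (hs : (spectralRadius ℝ T).toReal < s) :
    s ∈ resolventSet ℝ T := by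
  apply spectrum.mem_resolventSet_of_spectralRadius_lt
  have h0 : 0 ≤ s := ENNReal.toReal_nonneg.trans hs.le
  rw [← ENNReal.toReal_lt_toReal (aux_radius_ne_top T) ENNReal.coe_ne_top]
  simpa [abs_of_nonneg h0] using hs

theorem aux_inv {X : Type*} [TopologicalSpace X] [CompactSpace X] [Nonempty X]
    (T : C(X, ℝ) →L[ℝ] C(X, ℝ)) {s : ℝ} (hs : s ∈ resolventSet ℝ T) (f : C(X, ℝ)) :
    s • resolvent T s f - T (resolvent T s f) = f := by
  have := Ring.mul_inverse_cancel _ (spectrum.mem_resolventSet_iff.1 hs)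
  have := congrArg (fun A : C(X, ℝ) →L[ℝ] C(X, ℝ) => A f) this
  simpa [resolvent, Algebra.algebraMap_eq_smul_one] using this

theorem aux_inv' {X : Type*} [TopologicalSpace X] [CompactSpace X] [Nonempty X]
    (T : C(X, ℝ) →L[ℝ] C(X, ℝ)) {s : ℝ} (hs : s ∈ resolventSet ℝ T) (f : C(X, ℝ)) :
    resolvent T s (s • f - T f) = f := by
  have := Ring.inverse_mul_cancel _ (spectrum.mem_resolventSet_iff.1 hs)
  have := congrArg (fun A : C(X, ℝ) →L[ℝ] C(X, ℝ) => A f) this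
  simpa [resolvent, Algebra.algebraMap_eq_smul_one] using this

theorem aux_resolvent_pos {X : Type*} [TopologicalSpace X] [CompactSpace X] [Nonempty X]
    (T : C(X, ℝ) →L[ℝ] C(X, ℝ)) (hT : ∀ f, 0 ≤ f → 0 ≤ T f) {s : ℝ}
    (hs : (spectralRadius ℝ T).toReal < s) : ∀ f, 0 ≤ f → 0 ≤ resolvent T s f := by
  set M : ℝ := max s (‖T 1‖ + 1) with hM
  have hMs : s ≤ M := le_max_left _ _
  have hMT : ‖T 1‖ < M := lt_of_lt_of_le (lt_add_one _) (le_max_right _ _)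
  have hM0 : 0 < M := (norm_nonneg (T 1)).trans_lt hMT
  have hMr : (spectralRadius ℝ T).toReal < M := hs.trans_le hMs
  set Pos : Set (C(X, ℝ) →L[ℝ] C(X, ℝ)) := {A | ∀ f, 0 ≤ f → 0 ≤ A f} with hPos
  have hPc : IsClosed Pos := by
    have : Pos = ⋂ (f : C(X, ℝ)) (_ : 0 ≤ f) (x : X), {A | 0 ≤ A f x} := by
      ext A
      simp only [hPos, Set.mem_ofPred_eq, Set.mem_iInter]
      rfl
    rw [this]
    refine isClosed_iInter fun f => isClosed_iInter fun _ => isClosed_iInter fun x => ?_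
    refine isClosed_le continuous_const ?_
    have : Continuous fun A : C(X, ℝ) →L[ℝ] C(X, ℝ) => A f := by fun_prop
    exact (continuous_eval_const x).comp this
  have hres : ∀ t ∈ Set.Icc (-M) (-s), -t ∈ resolventSet ℝ T := fun t ht =>
    aux_resolvent T (by have := ht.2; linarith)
  have hF : ContinuousOn (fun t : ℝ => resolvent T (-t)) (Set.Icc (-M) (-s)) := by
    intro t ht
    have h1 : ContinuousAt (resolvent T) (-t) := aux_cont T (hres t ht)
    exact (ContinuousAt.comp (f := fun t : ℝ => -t) h1 continuous_neg.continuousAt).continuousWithinAt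
  have hcl := hF.preimage_isClosed_of_isClosed isClosed_Icc hPc
  have hstart : ∀ f, 0 ≤ f → 0 ≤ resolvent T M f := by
    intro f hf
    refine aux_contr (M⁻¹ • T) ?_ ?_ _ ?_
    · intro g hg
      exact smul_nonneg (inv_nonneg.2 hM0.le) (hT g hg)
    · rw [_root_.smul_apply, norm_smul, norm_inv, Real.norm_of_nonneg hM0.le, inv_mul_lt_iff₀ hM0]
      simpa using hMT
    · have h := aux_inv T (aux_resolvent T hMr) f
      intro x
      have hx := congrArg (fun g : C(X, ℝ) => g x) h
      have hfx := hf x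
      simp at hx hfx ⊢
      rw [inv_mul_le_iff₀ hM0]
      linarith
  have key : -s ∈ (Set.Icc (-M) (-s) ∩ (fun t : ℝ => resolvent T (-t)) ⁻¹' Pos) := by
    refine IsClosed.mem_of_ge_of_forall_exists_gt (a := -M) (b := -s) ?_ ?_ (by linarith) ?_
    · have : Set.Icc (-M) (-s) ∩ (fun t : ℝ => resolvent T (-t)) ⁻¹' Pos ∩ Set.Icc (-M) (-s) =
        Set.Icc (-M) (-s) ∩ (fun t : ℝ => resolvent T (-t)) ⁻¹' Pos := by
          rw [Set.inter_eq_left]; exact Set.inter_subset_left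
      rw [this]; exact hcl
    · refine ⟨⟨le_rfl, by linarith⟩, ?_⟩
      simpa [hPos] using hstart
    · rintro t ⟨⟨ht1, ht2⟩, ht3⟩
      have ht4 := ht1.1
      set N := ‖resolvent T (-t) 1‖ with hN
      have hN0 : 0 ≤ N := norm_nonneg _
      set δ := min (-s - t) (1 / (N + 1)) with hδ
      have hδ0 : 0 < δ := lt_min (by linarith [ht3.2]) (by positivity)
      have hδ1 : δ ≤ -s - t := min_le_left _ _
      have hδ2 : δ * N < 1 := by
        have : δ ≤ 1 / (N + 1) := min_le_right _ _
        rw [le_div_iff₀ (by positivity)] at this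
        nlinarith
      refine ⟨t + δ, ⟨⟨by linarith, by linarith⟩, ?_⟩, by linarith, by linarith⟩
      intro f hf
      show 0 ≤ resolvent T (-(t + δ)) f
      have hm : -(t + δ) ∈ resolventSet ℝ T := hres _ ⟨by linarith, by linarith⟩
      have hm' : -t ∈ resolventSet ℝ T := hres _ ⟨by linarith, by linarith⟩
      refine aux_contr (δ • resolvent T (-t)) ?_ ?_ _ ?_
      · intro g hg
        exact smul_nonneg hδ0.le (ht2 g hg)
      · rw [_root_.smul_apply, norm_smul, Real.norm_of_nonneg hδ0.le]; exact hδ2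
      · set g := resolvent T (-(t + δ)) f with hg
        have h1 := aux_inv T hm f
        have h2 := aux_inv' T hm' g
        have h3 : (-t) • g - T g = f + δ • g := by
          rw [← h1, ← hg]; module
        rw [h3, map_add, map_smul] at h2
        have h4 : 0 ≤ resolvent T (-t) f := ht2 f hf
        calc (δ • resolvent T (-t)) g = δ • resolvent T (-t) g := rfl
          _ ≤ resolvent T (-t) f + δ • resolvent T (-t) g := le_add_of_nonneg_left h4
          _ = g := h2
  have := key.2
  simpa [hPos] using this

theorem aux_lower {X : Type*} [TopologicalSpace X] [CompactSpace X] [Nonempty X]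
    (T : C(X, ℝ) →L[ℝ] C(X, ℝ)) (hT : ∀ f, 0 ≤ f → 0 ≤ T f) (c : ℝ) (u : C(X, ℝ))
    (hu : 0 ≤ u) (hu0 : u ≠ 0) (h : c • u ≤ T u) : c ≤ (spectralRadius ℝ T).toReal := by
  by_contra hc
  push Not at hc
  have h1 := aux_resolvent_pos T hT hc _ (sub_nonneg.2 h)
  have h2 := aux_inv' T (aux_resolvent T hc) u
  rw [← neg_sub, map_neg, h2] at h1
  exact hu0 (le_antisymm (neg_nonneg.1 h1) hu)

theorem aux_dual {X : Type*} [TopologicalSpace X] [CompactSpace X] [Nonempty X]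
    (T : C(X, ℝ) →L[ℝ] C(X, ℝ)) (hT : ∀ f, 0 ≤ f → 0 ≤ T f) (ψ : C(X, ℝ))
    (hψ : 0 ≤ ψ) (hψ0 : ψ ≠ 0) (h : (spectralRadius ℝ T).toReal • ψ ≤ T ψ) :
    ∃ ν : C(X, ℝ) →L[ℝ] ℝ, (∀ f, 0 ≤ f → 0 ≤ ν f) ∧ ν 1 = 1 ∧
      ∀ f, ν (T f) = (spectralRadius ℝ T).toReal * ν f := by
  set r := (spectralRadius ℝ T).toReal with hr
  have step : ∀ n : ℕ, ∃ ν : C(X, ℝ) →L[ℝ] ℝ, (∀ f, 0 ≤ f → 0 ≤ ν f) ∧ ν 1 = 1 ∧ (∀ f, |ν f| ≤ ‖f‖) ∧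
      ∀ f, |ν (T f) - r * ν f| ≤ 2 * ‖f‖ * (1 / ((n : ℝ) + 1)) := by
    intro n
    set e : ℝ := 1 / ((n : ℝ) + 1) with he
    have he0 : 0 < e := by positivity
    have hs : r < r + e := by linarith
    have hR := aux_resolvent_pos T hT hs
    have hm := aux_resolvent T hs
    set R := resolvent T (r + e) with hRdef
    obtain ⟨x1, -, hx1⟩ := isCompact_univ.exists_isMaxOn Set.univ_nonempty
      ψ.continuous.continuousOn
    have hx1 : ∀ x, ψ x ≤ ψ x1 := fun x => hx1 (Set.mem_univ x)
    have hp : 0 < ψ x1 := by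
      by_contra hc
      apply hψ0
      ext x
      have := hψ x
      exact le_antisymm ((hx1 x).trans (not_lt.1 hc)) this
    obtain ⟨x0, -, hx0⟩ := isCompact_univ.exists_isMaxOn Set.univ_nonempty
      (R 1).continuous.continuousOn
    have hx0 : ∀ x, R 1 x ≤ R 1 x0 := fun x => hx0 (Set.mem_univ x)
    set M := R 1 x0 with hMdef
    have hM : 1 ≤ e * M := by
      have a1 := ContinuousMap.le_def.1 (hR _ (sub_nonneg.2 h)) x1
      have a2 := congrArg (fun g : C(X, ℝ) => g x1) (aux_inv' T hm ψ)
      have a3 : 0 ≤ R (ψ x1 • (1 : C(X, ℝ)) - ψ) := by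
        apply hR
        intro x
        simpa using hx1 x
      have a3 := ContinuousMap.le_def.1 a3 x1
      have a4 := hx0 x1
      simp only [map_sub, map_smul, ContinuousMap.zero_apply,
        ContinuousMap.sub_apply, ContinuousMap.smul_apply, smul_eq_mul, ← hRdef] at a1 a2 a3
      have : ψ x1 ≤ e * (ψ x1 * M) := by
        have : R ψ x1 ≤ ψ x1 * M := by nlinarith
        nlinarith
      by_contra hc
      nlinarith
    have hM0 : 0 < M := by
      by_contra hc
      nlinarith
    have hMi : M⁻¹ ≤ e := by
      rw [inv_le_iff_one_le_mul₀ hM0]; exact hM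
    have hpos : ∀ f, 0 ≤ f → 0 ≤ (M⁻¹ • (ContinuousMap.evalCLM ℝ x0).comp R) f := by
      intro f hf
      exact mul_nonneg (inv_nonneg.2 hM0.le) (hR f hf x0)
    have hone : (M⁻¹ • (ContinuousMap.evalCLM ℝ x0).comp R) 1 = 1 := by
      show M⁻¹ * M = 1
      exact inv_mul_cancel₀ hM0.ne'
    refine ⟨M⁻¹ • (ContinuousMap.evalCLM ℝ x0).comp R, hpos, hone, ?_, ?_⟩
    all_goals generalize hν : M⁻¹ • (ContinuousMap.evalCLM ℝ x0).comp R = ν at *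
    all_goals
      have hb : ∀ f, |ν f| ≤ ‖f‖ := by
        intro f
        have b1 : 0 ≤ ν (‖f‖ • 1 - f) := hpos _ (by
          intro x
          have := (le_abs_self (f x)).trans (f.norm_coe_le_norm x)
          simpa using this)
        have b2 : 0 ≤ ν (‖f‖ • 1 + f) := hpos _ (by
          intro x
          have := (neg_abs_le (f x))
          have := f.norm_coe_le_norm x
          rw [Real.norm_eq_abs] at this
          simp
          linarith)
        simp only [map_sub, map_add, map_smul, hone, smul_eq_mul, mul_one] at b1 b2
        exact abs_le.2 ⟨by linarith, by linarith⟩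
    · exact hb
    · intro f
      have c1 := congrArg (fun g : C(X, ℝ) => M⁻¹ * g x0) (aux_inv' T hm f)
      have c2 : ν ((r + e) • f - T f) = M⁻¹ * f x0 := by
        rw [← c1, ← hν]; rfl
      rw [map_sub, map_smul, smul_eq_mul] at c2
      have c3 : ν (T f) - r * ν f = e * ν f - M⁻¹ * f x0 := by linarith
      rw [c3]
      refine (abs_sub _ _).trans ?_
      rw [abs_mul, abs_mul, abs_of_pos he0, abs_of_pos (inv_pos.2 hM0)]
      have d1 := hb f
      have d2 := f.norm_coe_le_norm x0
      rw [Real.norm_eq_abs] at d2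
      have d3 := mul_le_mul hMi d2 (abs_nonneg _) he0.le
      have d4 := mul_le_mul_of_nonneg_left d1 he0.le
      linarith
  choose ν h1 h2 h3 h4 using step
  let U : Filter ℕ := (Filter.hyperfilter ℕ : Ultrafilter ℕ)
  have hU : U ≤ Filter.atTop := by
    rw [← Nat.cofinite_eq_atTop]; exact Filter.hyperfilter_le_cofinite
  obtain ⟨μ, hlim⟩ := aux_limit ν h3
  have : U.NeBot := by infer_instance
  refine ⟨μ, ?_, ?_, ?_⟩
  · intro f hf
    exact ge_of_tendsto' (hlim f) fun n => h1 n f hf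
  · exact tendsto_nhds_unique (hlim 1) (by simp only [h2]; exact tendsto_const_nhds)
  · intro f
    show μ (T f) = r * μ f
    have e1 := (hlim (T f)).sub ((hlim f).const_mul r)
    have e2 : Filter.Tendsto (fun n => ν n (T f) - r * ν n f) U (nhds 0) := by
      refine squeeze_zero_norm (fun n => h4 n f) ?_
      have := (tendsto_one_div_add_atTop_nhds_zero_nat (𝕜 := ℝ)).const_mul (2 * ‖f‖)
      rw [mul_zero] at this
      exact this.mono_left hU
    exact sub_eq_zero.1 (tendsto_nhds_unique e1 e2)

theorem aux_finite {d : ℕ} (K : Set (EuclideanSpace ℝ (Fin d))) [CompactSpace ↥K] :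
    IsFiniteMeasure (lebOn K) := by
  have hK : IsCompact K := isCompact_iff_compactSpace.2 inferInstance
  constructor
  rw [lebOn, (MeasurableEmbedding.subtype_coe hK.measurableSet).comap_apply]
  exact (measure_mono (Set.image_subset_iff.2 fun x _ => x.2)).trans_lt hK.measure_lt_top

theorem aux_dense {d : ℕ} (K : Set (EuclideanSpace ℝ (Fin d)))
    (hKreg : K = closure (interior K)) :
    Dense {x : ↥K | (x : EuclideanSpace ℝ (Fin d)) ∈ interior K} := by
  intro x
  rw [closure_subtype]
  have hx : (x : EuclideanSpace ℝ (Fin d)) ∈ closure (interior K) := hKreg ▸ x.2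
  refine closure_mono ?_ hx
  intro y hy
  exact ⟨⟨y, interior_subset hy⟩, hy, rfl⟩

theorem aux_openpos {d : ℕ} (K : Set (EuclideanSpace ℝ (Fin d))) [CompactSpace ↥K]
    (hKreg : K = closure (interior K)) : (lebOn K).IsOpenPosMeasure := by
  have hK : IsCompact K := isCompact_iff_compactSpace.2 inferInstance
  constructor
  intro U hU hne
  rw [lebOn, (MeasurableEmbedding.subtype_coe hK.measurableSet).comap_apply]
  obtain ⟨x, hxU, hx⟩ := (aux_dense K hKreg).inter_open_nonempty U hU hne |>.imp fun _ h => h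
  obtain ⟨V, hV, rfl⟩ := isOpen_induced_iff.1 hU
  have hop : IsOpen (V ∩ interior K) := hV.inter isOpen_interior
  have h0 := hop.measure_ne_zero volume ⟨x, hxU, hx⟩
  intro h
  refine h0 (measure_mono_null ?_ h)
  rintro y ⟨hy1, hy2⟩
  exact ⟨⟨y, interior_subset hy2⟩, hy1, rfl⟩

theorem aux_integrable {d : ℕ} (K : Set (EuclideanSpace ℝ (Fin d))) [CompactSpace ↥K]
    {E : Type*} [NormedAddCommGroup E] {f : ↥K → E} (hf : Continuous f) :
    Integrable f (lebOn K) := by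
  have := aux_finite K
  exact hf.integrable_of_hasCompactSupport (HasCompactSupport.of_compactSpace f)

theorem aux_pos {d : ℕ} (K : Set (EuclideanSpace ℝ (Fin d))) [CompactSpace ↥K]
    (hKreg : K = closure (interior K)) {f : ↥K → ℝ} (hf : Continuous f) (h0 : ∀ x, 0 ≤ f x)
    {x : ↥K} (hx : f x ≠ 0) : 0 < ∫ y, f y ∂(lebOn K) := by
  have := aux_finite K
  have := aux_openpos K hKreg
  exact hf.integral_pos_of_hasCompactSupport_nonneg_nonzero
    (HasCompactSupport.of_compactSpace f) h0 hx

/-- The main equality: a positive subinvariant function is invariant. -/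
theorem aux_main {d : ℕ} (K : Set (EuclideanSpace ℝ (Fin d)))
    [Nonempty ↥K] [CompactSpace ↥K]
    (hKint : (interior K).Nonempty) (hKreg : K = closure (interior K))
    (P : ↥K × ↥K → ℝ) (hPcont : Continuous P)
    (hPnonneg : ∀ x y : ↥K, 0 ≤ P (x, y))
    (hPpos : ∀ x y : ↥K, (x : EuclideanSpace ℝ (Fin d)) ∈ interior K →
      (y : EuclideanSpace ℝ (Fin d)) ∈ interior K → 0 < P (x, y))
    (T : C(↥K, ℝ) →L[ℝ] C(↥K, ℝ))
    (hT : ∀ (β : C(↥K, ℝ)) (x : ↥K), T β x = ∫ y : ↥K, β y * P (x, y) ∂(lebOn K)) :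
    0 < (spectralRadius ℝ T).toReal ∧
    (∀ ψ : C(↥K, ℝ), 0 ≤ ψ → ψ ≠ 0 → ∀ x : ↥K, (x : EuclideanSpace ℝ (Fin d)) ∈ interior K →
      0 < T ψ x) ∧
    ∀ ψ : C(↥K, ℝ), 0 ≤ ψ → ψ ≠ 0 → (spectralRadius ℝ T).toReal • ψ ≤ T ψ →
      T ψ = (spectralRadius ℝ T).toReal • ψ := by
  have hTpos : ∀ f, 0 ≤ f → 0 ≤ T f := by
    intro f hf
    rw [ContinuousMap.le_def]
    intro x
    rw [hT]
    exact integral_nonneg fun y => mul_nonneg (ContinuousMap.le_def.1 hf y) (hPnonneg x y)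
  have hcx : ∀ x, Continuous fun y => P (x, y) := fun x => by fun_prop
  have hdense := aux_dense K hKreg
  have hstrict : ∀ ψ : C(↥K, ℝ), 0 ≤ ψ → ψ ≠ 0 → ∀ x : ↥K,
      (x : EuclideanSpace ℝ (Fin d)) ∈ interior K → 0 < T ψ x := by
    intro ψ hψ hψ0 x hx
    rw [hT]
    obtain ⟨y, hy, hyi⟩ : ∃ y : ↥K, ψ y ≠ 0 ∧ (y : EuclideanSpace ℝ (Fin d)) ∈ interior K := by
      by_contra hc
      push Not at hc
      apply hψ0
      ext z
      have : (ψ : ↥K → ℝ) = fun _ => 0 :=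
        Continuous.ext_on hdense ψ.continuous continuous_const fun y hy => by
          by_contra h
          exact hc y h hy
      exact congrFun this z
    exact aux_pos K hKreg (x := y) (by fun_prop)
      (fun y => mul_nonneg (ContinuousMap.le_def.1 hψ y) (hPnonneg x y))
      (mul_ne_zero hy (hPpos x y hx hyi).ne')
  have hr : 0 < (spectralRadius ℝ T).toReal := by
    obtain ⟨v, hv⟩ := hKint
    set x0 : ↥K := ⟨v, interior_subset hv⟩ with hx0
    have hp := hPpos x0 x0 hv hv
    set c := P (x0, x0) / 2 with hc
    have hc0 : 0 < c := by positivity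
    have hev : ∀ᶠ z in nhds (x0, x0), c < P z :=
      hPcont.continuousAt.eventually (lt_mem_nhds (by linarith))
    obtain ⟨ρ, hρ, hball⟩ := Metric.eventually_nhds_iff.1 hev
    let u : C(↥K, ℝ) := ⟨fun x => max 0 (ρ - dist x x0), by fun_prop⟩
    have hu : ∀ x, u x = max 0 (ρ - dist x x0) := fun x => rfl
    have hu0 : ∀ x, 0 ≤ u x := fun x => le_max_left _ _
    have hux0 : u x0 = ρ := by simp [hu, hρ.le]
    have huρ : ∀ x, u x ≤ ρ := fun x => max_le hρ.le (by linarith [dist_nonneg (x := x) (y := x0)])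
    have hus : ∀ x, u x ≠ 0 → dist x x0 < ρ := by
      intro x hx
      by_contra h
      exact hx (max_eq_left (by linarith))
    set I := ∫ y, u y ∂(lebOn K) with hI
    have hI0 : 0 < I := aux_pos K hKreg u.continuous hu0 (x := x0) (by rw [hux0]; exact hρ.ne')
    refine lt_of_lt_of_le (div_pos (mul_pos hc0 hI0) hρ)
      (aux_lower T hTpos _ u (ContinuousMap.le_def.2 hu0) ?_ ?_)
    · intro h
      rw [h] at hux0
      exact hρ.ne hux0
    · rw [ContinuousMap.le_def]
      intro x
      show c * I / ρ * u x ≤ T u x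
      by_cases hx : u x = 0
      · rw [hx, mul_zero]
        exact ContinuousMap.le_def.1 (hTpos u (ContinuousMap.le_def.2 hu0)) x
      · have h1 : c * I / ρ * u x ≤ I * c := by
          rw [div_mul_eq_mul_div, div_le_iff₀ hρ]
          have := mul_le_mul_of_nonneg_left (huρ x) (mul_pos hc0 hI0).le
          linarith
        refine h1.trans ?_
        rw [hT, hI, ← integral_mul_const]
        refine integral_mono (aux_integrable K (by fun_prop)) (aux_integrable K (by fun_prop)) ?_
        intro y
        show u y * c ≤ u y * P (x, y)
        by_cases hy : u y = 0
        · simp [hy]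
        · refine mul_le_mul_of_nonneg_left (hball ?_).le (hu0 y)
          rw [Prod.dist_eq]
          exact max_lt (hus x hx) (hus y hy)
  refine ⟨hr, hstrict, ?_⟩
  intro ψ hψ hψ0 hsub
  obtain ⟨ν, hν, hν1, hνT⟩ := aux_dual T hTpos ψ hψ hψ0 hsub
  set r := (spectralRadius ℝ T).toReal with hrdef
  by_contra hne
  set η := T ψ - r • ψ with hη
  have hη0 : 0 ≤ η := sub_nonneg.2 hsub
  have hηne : η ≠ 0 := fun h => hne (sub_eq_zero.1 h)
  have hνη : ν η = 0 := by rw [hη, map_sub, hνT, map_smul, smul_eq_mul, sub_self]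
  let Q : C(↥K × ↥K, ℝ) := ⟨fun p => P (p.2, p.1), by fun_prop⟩
  let p : C(↥K, C(↥K, ℝ)) := Q.curry
  have hpx : ∀ y x, p y x = P (x, y) := fun _ _ => rfl
  have hTb : ∀ f : C(↥K, ℝ), T f = ∫ y, f y • p y ∂(lebOn K) := by
    intro f
    ext x
    have hi : Integrable (fun y => f y • p y) (lebOn K) := aux_integrable K (by fun_prop)
    have := (ContinuousMap.evalCLM ℝ x).integral_comp_comm hi
    rw [hT]
    exact this
  have hνT' : ∀ f : C(↥K, ℝ), ν (T f) = ∫ y, f y * ν (p y) ∂(lebOn K) := by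
    intro f
    have hi : Integrable (fun y => f y • p y) (lebOn K) := aux_integrable K (by fun_prop)
    rw [hTb, ← ν.integral_comp_comm hi]
    simp
  have hq0 : ∀ y, 0 ≤ ν (p y) := fun y =>
    hν _ (ContinuousMap.le_def.2 fun x => hPnonneg x y)
  have hqc : Continuous fun y => ν (p y) := by fun_prop
  have hTη := hTpos η hη0
  have hz : ν (T (T η)) = 0 := by rw [hνT, hνT, hνη]; simp
  have hqi : ∀ y : ↥K, (y : EuclideanSpace ℝ (Fin d)) ∈ interior K → ν (p y) = 0 := by
    intro y hy
    by_contra h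
    have := aux_pos K hKreg (f := fun y => T η y * ν (p y)) (x := y) (by fun_prop)
      (fun y => mul_nonneg (ContinuousMap.le_def.1 hTη y) (hq0 y))
      (mul_ne_zero (hstrict η hη0 hηne y hy).ne' h)
    rw [← hνT', hz] at this
    exact lt_irrefl _ this
  have hq : (fun y => ν (p y)) = fun _ => 0 :=
    Continuous.ext_on hdense hqc continuous_const hqi
  have h1 : ν (T 1) = 0 := by
    rw [hνT']
    simp [fun y => congrFun hq y]
  rw [hνT, hν1, mul_one] at h1
  exact hr.ne' h1

theorem stmt_4 {d : ℕ} (K : Set (EuclideanSpace ℝ (Fin d)))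
    [Nonempty ↥K] [CompactSpace ↥K]
    (hKint : (interior K).Nonempty) (hKreg : K = closure (interior K))
    (P : ↥K × ↥K → ℝ) (hPcont : Continuous P)
    (hPnonneg : ∀ x y : ↥K, 0 ≤ P (x, y))
    (hPpos : ∀ x y : ↥K, (x : EuclideanSpace ℝ (Fin d)) ∈ interior K →
      (y : EuclideanSpace ℝ (Fin d)) ∈ interior K → 0 < P (x, y))
    (hPsub : ∀ x : ↥K, ∫ y : ↥K, P (x, y) ∂(lebOn K) ≤ 1)
    (T : C(↥K, ℝ) →L[ℝ] C(↥K, ℝ))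
    (hT : ∀ (β : C(↥K, ℝ)) (x : ↥K), T β x = ∫ y : ↥K, β y * P (x, y) ∂(lebOn K))
    (TC : C(↥K, ℂ) →L[ℂ] C(↥K, ℂ))
    (hTC : ∀ (β : C(↥K, ℂ)) (x : ↥K),
      TC β x = ∫ y : ↥K, β y * (P (x, y) : ℂ) ∂(lebOn K))
    (l : ℂ) (φ : C(↥K, ℂ)) (hφ : φ ≠ 0) (heig : TC φ = l • φ)
    (hmod : ‖l‖ = (spectralRadius ℝ T).toReal) :
    l = ((spectralRadius ℝ T).toReal : ℂ) ∧
    ∃ z : ℂ, ‖z‖ = 1 ∧ ∀ x : ↥K, φ x = z * (‖φ x‖ : ℂ) := by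
  obtain ⟨hr, hstrict, hmain⟩ := aux_main K hKint hKreg P hPcont hPnonneg hPpos T hT
  set r := (spectralRadius ℝ T).toReal with hrdef
  let ψ : C(↥K, ℝ) := ⟨fun x => ‖φ x‖, by fun_prop⟩
  have hψx : ∀ x, ψ x = ‖φ x‖ := fun _ => rfl
  have hψ : 0 ≤ ψ := ContinuousMap.le_def.2 fun x => by
    show (0 : ℝ) ≤ ‖φ x‖
    exact norm_nonneg _
  have hψ0 : ψ ≠ 0 := by
    intro h
    apply hφ
    ext x
    have := congrArg (fun g : C(↥K, ℝ) => g x) h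
    exact norm_eq_zero.1 this
  have heigx : ∀ x, ∫ y : ↥K, φ y * (P (x, y) : ℂ) ∂(lebOn K) = l * φ x := by
    intro x
    rw [← hTC, heig]; rfl
  have hsub : r • ψ ≤ T ψ := by
    rw [ContinuousMap.le_def]
    intro x
    show r * ‖φ x‖ ≤ T ψ x
    rw [← hmod, ← norm_mul, ← heigx, hT]
    refine (norm_integral_le_integral_norm _).trans (le_of_eq ?_)
    congr 1
    ext y
    rw [norm_mul, Complex.norm_real, Real.norm_of_nonneg (hPnonneg x y)]
    rfl
  have hTψ := hmain ψ hψ hψ0 hsub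
  have hTψx : ∀ x, ∫ y : ↥K, ‖φ y‖ * P (x, y) ∂(lebOn K) = r * ‖φ x‖ := by
    intro x
    have := congrArg (fun g : C(↥K, ℝ) => g x) hTψ
    rw [show T ψ x = _ from hT ψ x] at this
    exact this
  obtain ⟨v, hv⟩ := hKint
  set x0 : ↥K := ⟨v, interior_subset hv⟩ with hx0
  have hφx0 : 0 < ‖φ x0‖ := by
    have h1 := hstrict ψ hψ hψ0 x0 hv
    rw [hTψ] at h1
    have h1 : 0 < r * ‖φ x0‖ := h1
    exact pos_of_mul_pos_right h1 hr.le
  set a : ℂ := l * φ x0 with ha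
  have hna : ‖a‖ = r * ‖φ x0‖ := by rw [ha, norm_mul, hmod]
  have hna0 : 0 < ‖a‖ := by rw [hna]; positivity
  have hna' : (‖a‖ : ℂ) ≠ 0 := by exact_mod_cast hna0.ne'
  set z : ℂ := a / ‖a‖ with hz
  have hz1 : ‖z‖ = 1 := by
    rw [hz, norm_div, Complex.norm_real, norm_norm, div_self hna0.ne']
  set w : ℂ := (starRingEnd ℂ) z with hw
  have hw1 : ‖w‖ = 1 := by rw [hw, RCLike.norm_conj, hz1]
  have hzw : z * w = 1 := by
    rw [hw, Complex.mul_conj, Complex.normSq_eq_norm_sq, hz1]; simp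
  have hwa : w * a = ‖a‖ := by
    have : a = z * ‖a‖ := by rw [hz, div_mul_cancel₀ _ hna']
    rw [this, ← mul_assoc, mul_comm w z, hzw, one_mul, ← this]
  have hre_le : ∀ y, (w * φ y).re ≤ ‖φ y‖ := by
    intro y
    refine (Complex.re_le_norm _).trans ?_
    rw [norm_mul, hw1, one_mul]
  have hint : ∫ y : ↥K, (w * φ y).re * P (x0, y) ∂(lebOn K) = r * ‖φ x0‖ := by
    have hi : Integrable (fun y => w * (φ y * (P (x0, y) : ℂ))) (lebOn K) :=
      aux_integrable K (by fun_prop)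
    have h1 := Complex.reCLM.integral_comp_comm hi
    rw [integral_const_mul, heigx, ← ha, hwa] at h1
    rw [← hna]
    refine Eq.trans ?_ h1
    congr 1
    ext y
    rw [← mul_assoc]
    simp
  have hzero : ∫ y : ↥K, (‖φ y‖ - (w * φ y).re) * P (x0, y) ∂(lebOn K) = 0 := by
    simp only [sub_mul]
    rw [integral_sub (aux_integrable K (by fun_prop)) (aux_integrable K (by fun_prop)), hint,
      hTψx, sub_self]
  have hin : ∀ y : ↥K, (y : EuclideanSpace ℝ (Fin d)) ∈ interior K → (w * φ y).re = ‖φ y‖ := by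
    intro y hy
    by_contra h
    have := aux_pos K hKreg (f := fun y => (‖φ y‖ - (w * φ y).re) * P (x0, y)) (x := y)
      (by fun_prop) (fun y => mul_nonneg (sub_nonneg.2 (hre_le y)) (hPnonneg x0 y))
      (mul_ne_zero (sub_ne_zero.2 (Ne.symm h)) (hPpos x0 y hv hy).ne')
    exact this.ne' hzero
  have hall : (fun y => (w * φ y).re) = fun y => ‖φ y‖ :=
    Continuous.ext_on (aux_dense K hKreg) (by fun_prop) (by fun_prop) hin
  have hphase : ∀ y, φ y = z * (‖φ y‖ : ℂ) := by
    intro y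
    have h1 : (w * φ y).re = ‖w * φ y‖ := by
      rw [norm_mul, hw1, one_mul]; exact congrFun hall y
    have h2 : w * φ y = (‖φ y‖ : ℂ) := by
      have h3 := Complex.re_eq_norm.1 h1
      have h4 := Complex.eq_re_of_ofReal_le h3
      rw [h4, congrFun hall y]
    rw [← h2, ← mul_assoc, hzw, one_mul]
  refine ⟨?_, z, hz1, hphase⟩
  have h1 : a = r * φ x0 := by
    have : a = z * ‖a‖ := by rw [hz, div_mul_cancel₀ _ hna']
    rw [this, hna, hphase x0]
    simp [hz1]
    ring
  exact mul_right_cancel₀ (norm_pos_iff.1 hφx0) h1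
end

section
/- The integral operator T has a nonzero spectral gap: there exists ρ with 0 ≤ ρ < r such that every eigenvalue λ ∈ ℂ of T_ℂ with λ ≠ r satisfies |λ| ≤ ρ, where r is the spectral radius of T. -/
open MeasureTheory

open Filter Topology

section Abstract

variable {X : Type*} [MetricSpace X] [CompactSpace X] [MeasurableSpace X] [BorelSpace X]
  {m : Measure X} [IsFiniteMeasure m]

lemma sg_integrable {E : Type*} [NormedAddCommGroup E] {f : X → E} (hf : Continuous f) : Integrable f m :=
  hf.integrable_of_hasCompactSupport (HasCompactSupport.of_compactSpace f)

/-- Relative compactness of the image of a bounded set under an integral operator. -/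
lemma sg_compact (m : Measure X) [IsFiniteMeasure m] (𝕜 : Type*) [RCLike 𝕜] (Q : C(X × X, ℝ)) (M : ℝ) :
    ∃ A : Set C(X, 𝕜), IsCompact A ∧ ∀ f g : C(X, 𝕜), ‖g‖ ≤ M →
      (∀ x, f x = ∫ y, g y * ((Q (x, y) : ℝ) : 𝕜) ∂m) → f ∈ A := by
  let k : C(X, C(X, ℝ)) := Q.curry
  let C : ℝ := M * ‖Q‖ * m.real Set.univ
  let D : ℝ := M * m.real Set.univ
  let B : Set (X → 𝕜) := {f | (∀ x, ‖f x‖ ≤ C) ∧ ∀ x x', ‖f x - f x'‖ ≤ D * ‖k x - k x'‖}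
  have hBcont : ∀ f ∈ B, ∀ x₀, ∀ ε > 0, ∃ δ > 0, ∀ x, dist x x₀ < δ → D * ‖k x - k x₀‖ < ε := by
    intro f _ x₀ ε hε
    have hc : Continuous fun x => D * ‖k x - k x₀‖ := by fun_prop
    have h0 : Tendsto (fun x => D * ‖k x - k x₀‖) (𝓝 x₀) (𝓝 0) := by
      have := hc.tendsto x₀
      simpa using this
    exact Metric.eventually_nhds_iff.1 (h0.eventually_lt_const hε)
  refine ⟨{f | (f : X → 𝕜) ∈ B}, ?_, ?_⟩
  · apply ArzelaAscoli.isCompact_of_equicontinuous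
    · have : (ContinuousMap.toFun '' {f : C(X, 𝕜) | (f : X → 𝕜) ∈ B}) = B := by
        ext f
        constructor
        · rintro ⟨g, hg, rfl⟩
          exact hg
        · intro hf
          refine ⟨⟨f, ?_⟩, hf, rfl⟩
          rw [Metric.continuous_iff]
          intro x₀ ε hε
          obtain ⟨δ, hδ, h⟩ := hBcont f hf x₀ ε hε
          refine ⟨δ, hδ, fun x hx => ?_⟩
          rw [dist_eq_norm]
          exact (hf.2 x x₀).trans_lt (h x hx)
      rw [this]
      have hc : IsCompact (Set.univ.pi fun _ : X => Metric.closedBall (0 : 𝕜) C) :=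
        isCompact_univ_pi fun _ => isCompact_closedBall _ _
      refine hc.of_isClosed_subset ?_ ?_
      · have : B = (⋂ x, {f : X → 𝕜 | ‖f x‖ ≤ C}) ∩ ⋂ x, ⋂ x', {f | ‖f x - f x'‖ ≤ D * ‖k x - k x'‖} := by
          ext f; simp [B]
        rw [this]
        refine (isClosed_iInter fun x => isClosed_le (by fun_prop) (by fun_prop)).inter
          (isClosed_iInter fun x => isClosed_iInter fun x' => isClosed_le (by fun_prop) (by fun_prop))
      · intro f hf x _
        simpa using hf.1 x
    · intro x₀
      rw [Metric.equicontinuousAt_iff]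
      intro ε hε
      by_cases hne : ∃ f, f ∈ B
      · obtain ⟨f, hf⟩ := hne
        obtain ⟨δ, hδ, h⟩ := hBcont f hf x₀ ε hε
        refine ⟨δ, hδ, fun x hx g => ?_⟩
        rw [dist_eq_norm, norm_sub_rev]
        exact (g.2.2 x x₀).trans_lt (h x hx)
      · exact ⟨1, one_pos, fun x hx g => (hne ⟨_, g.2⟩).elim⟩
  · intro f g hg hf
    have hM : 0 ≤ M := (norm_nonneg _).trans hg
    constructor
    · intro x
      rw [hf]
      refine norm_integral_le_of_norm_le_const (Eventually.of_forall fun y => ?_)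
      rw [norm_mul, RCLike.norm_ofReal]
      exact mul_le_mul ((g.norm_coe_le_norm y).trans hg) (Q.norm_coe_le_norm (x, y)) (abs_nonneg _) hM
    · intro x x'
      rw [hf, hf, ← integral_sub (sg_integrable (by fun_prop)) (sg_integrable (by fun_prop))]
      calc _ ≤ (M * ‖k x - k x'‖) * m.real Set.univ := by
            refine norm_integral_le_of_norm_le_const (Eventually.of_forall fun y => ?_)
            rw [← mul_sub, norm_mul, ← RCLike.ofReal_sub, RCLike.norm_ofReal]
            exact mul_le_mul ((g.norm_coe_le_norm y).trans hg) ((k x - k x').norm_coe_le_norm y)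
              (abs_nonneg _) hM
        _ = _ := by simp only [D]; ring

lemma sg_continuous {E : Type*} [NormedAddCommGroup E] [NormedSpace ℝ E] {f : X → X → E}
    (hf : Continuous f.uncurry) : Continuous fun x => ∫ y, f x y ∂m := by
  simpa using continuous_parametric_integral_of_continuous (μ := m) hf isCompact_univ

lemma sg_swap {E : Type*} [NormedAddCommGroup E] [NormedSpace ℝ E] {f : X → X → E}
    (hf : Continuous f.uncurry) : ∫ x, ∫ y, f x y ∂m ∂m = ∫ y, ∫ x, f x y ∂m ∂m :=
  integral_integral_swap_of_hasCompactSupport hf (HasCompactSupport.of_compactSpace _)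

lemma sg_pos [m.IsOpenPosMeasure] {f : X → ℝ} (hf : Continuous f) (h0 : ∀ x, 0 ≤ f x) {x₀ : X}
    (hx : f x₀ ≠ 0) : 0 < ∫ x, f x ∂m :=
  hf.integral_pos_of_hasCompactSupport_nonneg_nonzero (HasCompactSupport.of_compactSpace _) h0 hx

lemma sg_zero [m.IsOpenPosMeasure] {f : X → ℝ} (hf : Continuous f) (h0 : ∀ x, 0 ≤ f x)
    (h : ∫ x, f x ∂m = 0) (x : X) : f x = 0 := by
  by_contra hx
  exact (sg_pos (m := m) hf h0 hx).ne' h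

/-- The integral operator with kernel `Q`. -/
noncomputable def sgOp (m : Measure X) [IsFiniteMeasure m] (Q : C(X × X, ℝ)) (g : C(X, ℝ)) : C(X, ℝ) :=
  ⟨fun x => ∫ y, g y * Q (x, y) ∂m, sg_continuous (by fun_prop)⟩

lemma sgOp_apply (Q : C(X × X, ℝ)) (g : C(X, ℝ)) (x : X) :
    sgOp m Q g x = ∫ y, g y * Q (x, y) ∂m := rfl

lemma sgOp_sub (Q : C(X × X, ℝ)) (g h : C(X, ℝ)) : sgOp m Q (g - h) = sgOp m Q g - sgOp m Q h := by
  ext x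
  simp only [sgOp_apply, ContinuousMap.sub_apply, sub_mul]
  exact integral_sub (sg_integrable (by fun_prop)) (sg_integrable (by fun_prop))

lemma sgOp_smul (Q : C(X × X, ℝ)) (c : ℝ) (g : C(X, ℝ)) : sgOp m Q (c • g) = c • sgOp m Q g := by
  ext x
  simp only [sgOp_apply, ContinuousMap.smul_apply, smul_eq_mul, mul_assoc]
  exact integral_const_mul _ _

lemma sgOp_norm_le (Q : C(X × X, ℝ)) (g : C(X, ℝ)) : ‖sgOp m Q g‖ ≤ ‖Q‖ * m.real Set.univ * ‖g‖ := by
  rw [ContinuousMap.norm_le _ (by positivity)]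
  intro x
  calc _ ≤ (‖g‖ * ‖Q‖) * m.real Set.univ := by
        refine norm_integral_le_of_norm_le_const (Eventually.of_forall fun y => ?_)
        rw [norm_mul]
        exact mul_le_mul (g.norm_coe_le_norm y) (Q.norm_coe_le_norm (x, y)) (norm_nonneg _) (norm_nonneg _)
    _ = _ := by ring

lemma sgOp_continuous (Q : C(X × X, ℝ)) : Continuous (sgOp m Q) := by
  refine LipschitzWith.continuous (K := ⟨‖Q‖ * m.real Set.univ, by positivity⟩) ?_
  refine LipschitzWith.of_dist_le_mul fun g h => ?_
  rw [dist_eq_norm, dist_eq_norm, ← sgOp_sub]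
  exact sgOp_norm_le Q _

lemma sgOp_nonneg (Q : C(X × X, ℝ)) (hQ : ∀ p, 0 ≤ Q p) (g : C(X, ℝ)) (hg : ∀ x, 0 ≤ g x) (x : X) :
    0 ≤ sgOp m Q g x := integral_nonneg fun y => mul_nonneg (hg y) (hQ _)

lemma sgOp_compact (m : Measure X) [IsFiniteMeasure m] (Q : C(X × X, ℝ)) (M : ℝ) :
    ∃ A : Set C(X, ℝ), IsCompact A ∧ ∀ g : C(X, ℝ), ‖g‖ ≤ M → sgOp m Q g ∈ A := by
  obtain ⟨A, hA, h⟩ := sg_compact m ℝ Q M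
  exact ⟨A, hA, fun g hg => h _ g hg fun x => rfl⟩

lemma sg_exists_norm [Nonempty X] {E : Type*} [NormedAddCommGroup E] (g : C(X, E)) : ∃ x, ‖g x‖ = ‖g‖ := by
  obtain ⟨x, -, hx⟩ := isCompact_univ.exists_isMaxOn (s := (Set.univ : Set X)) Set.univ_nonempty
    (f := fun x => ‖g x‖) (by fun_prop)
  refine ⟨x, le_antisymm (g.norm_coe_le_norm x) ?_⟩
  rw [ContinuousMap.norm_le _ (norm_nonneg _)]
  exact fun y => hx (Set.mem_univ y)

/-- Sub-eigenvectors of norm one. -/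
def sgSub (m : Measure X) [IsFiniteMeasure m] (Q : C(X × X, ℝ)) (l : ℝ) (g : C(X, ℝ)) : Prop :=
  ‖g‖ = 1 ∧ (∀ x, 0 ≤ g x) ∧ ∀ x, l * g x ≤ sgOp m Q g x

lemma sgSub_of (Q : C(X × X, ℝ)) (l : ℝ) (g : C(X, ℝ)) (hg : ∀ x, 0 ≤ g x) (hg0 : g ≠ 0)
    (h : ∀ x, l * g x ≤ sgOp m Q g x) : sgSub m Q l (‖g‖⁻¹ • g) := by
  have hn : 0 < ‖g‖ := norm_pos_iff.2 hg0
  refine ⟨?_, fun x => ?_, fun x => ?_⟩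
  · rw [norm_smul, norm_inv, norm_norm, inv_mul_cancel₀ hn.ne']
  · exact mul_nonneg (by positivity) (hg x)
  · rw [sgOp_smul]
    simp only [ContinuousMap.smul_apply, smul_eq_mul]
    have := mul_le_mul_of_nonneg_left (h x) (inv_nonneg.2 hn.le)
    linarith

lemma sgSub_le [Nonempty X] (Q : C(X × X, ℝ)) (l : ℝ) (g : C(X, ℝ)) (h : sgSub m Q l g) :
    l ≤ ‖sgOp m Q g‖ := by
  obtain ⟨x, hx⟩ := sg_exists_norm g
  have h1 : g x = 1 := by
    rw [← h.1, ← hx, Real.norm_of_nonneg (h.2.1 x)]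
  have h2 := h.2.2 x
  rw [h1, mul_one] at h2
  exact h2.trans ((le_abs_self _).trans ((sgOp m Q g).norm_coe_le_norm x))

lemma sgOp_mono (Q : C(X × X, ℝ)) (hQ : ∀ p, 0 ≤ Q p) (f g : C(X, ℝ)) (h : ∀ x, f x ≤ g x) (x : X) :
    sgOp m Q f x ≤ sgOp m Q g x := by
  have := sgOp_nonneg (m := m) Q hQ (g - f) (fun x => by simpa using h x) x
  rw [sgOp_sub] at this
  simpa using this

lemma sg_kr1 [Nonempty X] [m.IsOpenPosMeasure] (Q : C(X × X, ℝ)) (c : ℝ) (hc : 0 < c)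
    (hQ : ∀ p, c ≤ Q p) (R₀ : ℝ) (hR₀ : 0 < R₀) (g₀ : C(X, ℝ)) (hg₀ : sgSub m Q R₀ g₀) :
    ∃ R, R₀ ≤ R ∧ ∃ h : C(X, ℝ), ‖h‖ = 1 ∧ (∀ x, 0 ≤ h x) ∧ sgOp m Q h = R • h := by
  have hQ0 : ∀ p, 0 ≤ Q p := fun p => hc.le.trans (hQ p)
  let L : Set ℝ := {l | ∃ g, sgSub m Q l g}
  have hne : L.Nonempty := ⟨R₀, g₀, hg₀⟩
  have hbdd : BddAbove L := by
    refine ⟨‖Q‖ * m.real Set.univ, ?_⟩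
    rintro l ⟨g, hg⟩
    have := (sgSub_le Q l g hg).trans (sgOp_norm_le Q g)
    rwa [hg.1, mul_one] at this
  obtain ⟨u, -, hu, huL⟩ := exists_seq_tendsto_sSup hne hbdd
  set R := sSup L with hR
  have hR0 : R₀ ≤ R := le_csSup hbdd ⟨g₀, hg₀⟩
  have hRpos : 0 < R := hR₀.trans_le hR0
  choose g hg using huL
  obtain ⟨A, hA, hAm⟩ := sgOp_compact m Q 1
  obtain ⟨f, -, s, hs, hf⟩ := hA.tendsto_subseq (fun n => hAm (g n) (hg n).1.le)
  have hus : Tendsto (u ∘ s) atTop (𝓝 R) := hu.comp hs.tendsto_atTop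
  have hev : ∀ x, Tendsto (fun n => sgOp m Q (g (s n)) x) atTop (𝓝 (f x)) := fun x =>
    ((continuous_eval_const x).tendsto f).comp hf
  have hf0 : ∀ x, 0 ≤ f x := fun x =>
    ge_of_tendsto' (hev x) fun n => sgOp_nonneg Q hQ0 _ (hg _).2.1 x
  have hfn : R ≤ ‖f‖ := le_of_tendsto_of_tendsto' hus hf.norm fun n => sgSub_le Q _ _ (hg (s n))
  have hfne : f ≠ 0 := norm_pos_iff.1 (hRpos.trans_le hfn)
  have hsub : ∀ x, R * f x ≤ sgOp m Q f x := by
    intro x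
    have h1 : Tendsto (fun n => sgOp m Q (sgOp m Q (g (s n))) x) atTop (𝓝 (sgOp m Q f x)) :=
      (((continuous_eval_const x).comp (sgOp_continuous (m := m) Q)).tendsto f).comp hf
    refine le_of_tendsto_of_tendsto' (hus.mul (hev x)) h1 fun n => ?_
    have := sgOp_mono (m := m) Q hQ0 (u (s n) • g (s n)) (sgOp m Q (g (s n))) (hg (s n)).2.2 x
    rw [sgOp_smul] at this
    exact this
  have key : sgOp m Q f = R • f := by
    by_contra hcon
    let v : C(X, ℝ) := sgOp m Q f - R • f
    have hv0 : ∀ x, 0 ≤ v x := fun x => by simpa [v] using hsub x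
    have hvne : ∃ x, v x ≠ 0 := by
      by_contra! h
      exact hcon (sub_eq_zero.1 (ContinuousMap.ext h))
    obtain ⟨x₀, hx₀⟩ := hvne
    have hI : 0 < ∫ x, v x ∂m := sg_pos v.continuous hv0 hx₀
    have hfp0 : ∀ x, 0 ≤ sgOp m Q f x := fun x => (mul_nonneg hRpos.le (hf0 x)).trans (hsub x)
    have hfpne : sgOp m Q f ≠ 0 := by
      intro h
      apply hfne
      ext x
      have := hsub x
      rw [h] at this
      simp only [ContinuousMap.zero_apply] at this ⊢
      nlinarith [hf0 x]
    have hn : 0 < ‖sgOp m Q f‖ := norm_pos_iff.2 hfpne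
    let δ := c * (∫ x, v x ∂m) / ‖sgOp m Q f‖
    have hδ : 0 < δ := by positivity
    have hmem : R + δ ∈ L := by
      refine ⟨_, sgSub_of Q (R + δ) (sgOp m Q f) hfp0 hfpne fun x => ?_⟩
      have h1 : sgOp m Q v x = sgOp m Q (sgOp m Q f) x - R * sgOp m Q f x := by
        rw [sgOp_sub, sgOp_smul]; rfl
      have h2 : c * ∫ x, v x ∂m ≤ sgOp m Q v x := by
        rw [sgOp_apply, ← integral_const_mul]
        refine integral_mono (sg_integrable (by fun_prop)) (sg_integrable (by fun_prop)) fun y => ?_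
        rw [mul_comm c]
        exact mul_le_mul_of_nonneg_left (hQ _) (hv0 y)
      have h3 : δ * sgOp m Q f x ≤ c * ∫ x, v x ∂m := by
        calc _ ≤ δ * ‖sgOp m Q f‖ := mul_le_mul_of_nonneg_left
              ((le_abs_self _).trans ((sgOp m Q f).norm_coe_le_norm x)) hδ.le
          _ = _ := div_mul_cancel₀ _ hn.ne'
      linarith
    have := le_csSup hbdd hmem
    rw [← hR] at this
    linarith
  refine ⟨R, hR0, ‖f‖⁻¹ • f, ?_, fun x => mul_nonneg (by positivity) (hf0 x), ?_⟩
  · rw [norm_smul, norm_inv, norm_norm, inv_mul_cancel₀ (norm_ne_zero_iff.2 hfne)]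
  · rw [sgOp_smul, key, smul_comm]

lemma sg_kr2 [Nonempty X] [m.IsOpenPosMeasure] (Q : C(X × X, ℝ))
    (hQ : ∀ p, 0 ≤ Q p) (R₀ : ℝ) (hR₀ : 0 < R₀) (g₀ : C(X, ℝ)) (hg₀ : sgSub m Q R₀ g₀) :
    ∃ R, R₀ ≤ R ∧ ∃ h : C(X, ℝ), ‖h‖ = 1 ∧ (∀ x, 0 ≤ h x) ∧ sgOp m Q h = R • h := by
  let e : ℕ → ℝ := fun n => 1 / ((n : ℝ) + 1)
  have he : Tendsto e atTop (𝓝 0) := tendsto_one_div_add_atTop_nhds_zero_nat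
  have hep : ∀ n, 0 < e n := fun n => by positivity
  let J : C(X × X, ℝ) := ContinuousMap.const _ 1
  let Qn : ℕ → C(X × X, ℝ) := fun n => Q + e n • J
  have hop : ∀ n g, sgOp m (Qn n) g = sgOp m Q g + e n • sgOp m J g := by
    intro n g
    ext x
    simp only [sgOp_apply, ContinuousMap.add_apply, ContinuousMap.smul_apply, smul_eq_mul, Qn]
    rw [← integral_const_mul, ← integral_add (sg_integrable (by fun_prop)) (sg_integrable (by fun_prop))]
    congr 1
    ext y
    ring
  have hJ : ∀ p, 0 ≤ J p := fun p => by simp [J]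
  have h1 : ∀ n, ∃ R, R₀ ≤ R ∧ ∃ h : C(X, ℝ), ‖h‖ = 1 ∧ (∀ x, 0 ≤ h x) ∧ sgOp m (Qn n) h = R • h := by
    intro n
    refine sg_kr1 (Qn n) (e n) (hep n) (fun p => ?_) R₀ hR₀ g₀ ⟨hg₀.1, hg₀.2.1, fun x => ?_⟩
    · simp [Qn, J, hQ p]
    · rw [hop]
      have := mul_nonneg (hep n).le (sgOp_nonneg (m := m) J hJ g₀ hg₀.2.1 x)
      have := hg₀.2.2 x
      simp only [ContinuousMap.add_apply, ContinuousMap.smul_apply, smul_eq_mul]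
      linarith
  choose R hR h hn h0 heq using h1
  obtain ⟨A, hA, hAm⟩ := sgOp_compact m Q 1
  obtain ⟨f, -, s, hs, hf⟩ := hA.tendsto_subseq (fun n => hAm (h n) (hn n).le)
  have hpert : Tendsto (fun n => e n • sgOp m J (h n)) atTop (𝓝 0) := by
    refine squeeze_zero_norm (a := fun n => e n * (‖J‖ * m.real Set.univ)) (fun n => ?_) ?_
    · rw [norm_smul, Real.norm_of_nonneg (hep n).le]
      refine mul_le_mul_of_nonneg_left ?_ (hep n).le
      have := sgOp_norm_le (m := m) J (h n)
      rwa [hn, mul_one] at this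
    · simpa using he.mul_const (‖J‖ * m.real Set.univ)
  have hlim : Tendsto (fun n => R (s n) • h (s n)) atTop (𝓝 f) := by
    have := hf.add (hpert.comp hs.tendsto_atTop)
    rw [add_zero] at this
    refine this.congr fun n => ?_
    simp only [Function.comp]
    rw [← hop, heq]
  have hRlim : Tendsto (fun n => R (s n)) atTop (𝓝 ‖f‖) := by
    refine hlim.norm.congr fun n => ?_
    rw [norm_smul, hn, mul_one, Real.norm_of_nonneg (hR₀.le.trans (hR _))]
  have hfR : R₀ ≤ ‖f‖ := ge_of_tendsto' hRlim fun n => hR _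
  have hfp : 0 < ‖f‖ := hR₀.trans_le hfR
  have hhlim : Tendsto (fun n => h (s n)) atTop (𝓝 (‖f‖⁻¹ • f)) := by
    refine ((hRlim.inv₀ hfp.ne').smul hlim).congr fun n => ?_
    rw [smul_smul, inv_mul_cancel₀ (hR₀.trans_le (hR _)).ne', one_smul]
  refine ⟨‖f‖, hfR, ‖f‖⁻¹ • f, ?_, fun x => ?_, ?_⟩
  · rw [norm_smul, norm_inv, norm_norm, inv_mul_cancel₀ hfp.ne']
  · exact ge_of_tendsto' (((continuous_eval_const x).tendsto _).comp hhlim) fun n => h0 _ x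
  · rw [smul_smul, mul_inv_cancel₀ hfp.ne', one_smul]
    exact tendsto_nhds_unique (((sgOp_continuous (m := m) Q).tendsto _).comp hhlim) hf

lemma sg_left [Nonempty X] [m.IsOpenPosMeasure] (P : C(X × X, ℝ)) (hP : ∀ p, 0 ≤ P p)
    (U : Set X) (hU : IsOpen U) (hUd : Dense U) (hpos : ∀ x ∈ U, ∀ y ∈ U, 0 < P (x, y)) :
    ∃ R, 0 < R ∧ ∃ h : C(X, ℝ), (∀ x, 0 ≤ h x) ∧ (∀ x ∈ U, 0 < h x) ∧
      ∀ y, ∫ x, h x * P (x, y) ∂m = R * h y := by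
  let Q : C(X × X, ℝ) := P.comp ⟨Prod.swap, continuous_swap⟩
  have hQ : ∀ p, 0 ≤ Q p := fun p => hP _
  have hstrict : ∀ g : C(X, ℝ), (∀ x, 0 ≤ g x) → g ≠ 0 → ∀ x ∈ U, 0 < sgOp m Q g x := by
    intro g hg hg0 x hx
    have hex : ∃ z ∈ U, g z ≠ 0 := by
      by_contra! hcon
      apply hg0
      have : (g : X → ℝ) = fun _ => 0 := Continuous.ext_on hUd g.continuous continuous_const hcon
      ext z
      exact congrFun this z
    obtain ⟨z, hz, hgz⟩ := hex
    exact sg_pos (x₀ := z) (by fun_prop) (fun y => mul_nonneg (hg y) (hQ _))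
      (mul_ne_zero hgz (hpos z hz x hx).ne')
  obtain ⟨x₀, hx₀⟩ := hUd.nonempty
  obtain ⟨r, hr, hball⟩ := Metric.nhds_basis_closedBall.mem_iff.1 (hU.mem_nhds hx₀)
  let g : C(X, ℝ) := ⟨fun x => max 0 (r - dist x x₀), by fun_prop⟩
  have hg : ∀ x, 0 ≤ g x := fun x => le_max_left _ _
  have hg0 : g ≠ 0 := by
    intro h
    have h1 : g x₀ = r := by simp [g, hr.le]
    rw [h] at h1
    exact hr.ne h1
  have hcpt : IsCompact (Metric.closedBall x₀ r) := Metric.isClosed_closedBall.isCompact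
  obtain ⟨z, hz, hmin⟩ := hcpt.exists_isMinOn ⟨x₀, Metric.mem_closedBall_self hr.le⟩
    (sgOp m Q g).continuous.continuousOn
  have hc := hstrict g hg hg0 z (hball hz)
  set c := sgOp m Q g z with hcdef
  have hsub : ∀ x, c / r * g x ≤ sgOp m Q g x := by
    intro x
    by_cases hx : x ∈ Metric.closedBall x₀ r
    · have h1 : g x ≤ r := max_le hr.le (by linarith [dist_nonneg (x := x) (y := x₀)])
      calc c / r * g x ≤ c / r * r := by gcongr
        _ = c := div_mul_cancel₀ _ hr.ne'
        _ ≤ _ := hmin hx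
    · have h1 : g x = 0 := by
        rw [Metric.mem_closedBall, not_le] at hx
        exact max_eq_left (by linarith)
      rw [h1, mul_zero]
      exact sgOp_nonneg Q hQ g hg x
  obtain ⟨R, hR, h, hn, h0, heq⟩ := sg_kr2 (m := m) Q hQ (c / r) (by positivity) _
    (sgSub_of Q _ g hg hg0 hsub)
  have hRp : 0 < R := lt_of_lt_of_le (by positivity) hR
  have hne : h ≠ 0 := by
    rw [← norm_ne_zero_iff, hn]; exact one_ne_zero
  refine ⟨R, hRp, h, h0, fun x hx => ?_, fun y => ?_⟩
  · have := hstrict h h0 hne x hx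
    rw [heq] at this
    exact pos_of_mul_pos_right (a := R) this hRp.le
  · exact congrArg (fun f : C(X, ℝ) => f y) heq

lemma sg_pair {𝕜 : Type*} [RCLike 𝕜] (P : C(X × X, ℝ)) (R : ℝ) (h : C(X, ℝ))
    (heig : ∀ y, ∫ x, h x * P (x, y) ∂m = R * h y) (φ : C(X, 𝕜)) :
    ∫ x, (∫ y, φ y * ((P (x, y) : ℝ) : 𝕜) ∂m) * ((h x : ℝ) : 𝕜) ∂m
      = (R : 𝕜) * ∫ x, φ x * ((h x : ℝ) : 𝕜) ∂m := by
  calc _ = ∫ x, ∫ y, φ y * ((P (x, y) : ℝ) : 𝕜) * ((h x : ℝ) : 𝕜) ∂m ∂m := by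
        congr 1; ext x; rw [integral_mul_const]
    _ = ∫ y, ∫ x, φ y * ((P (x, y) : ℝ) : 𝕜) * ((h x : ℝ) : 𝕜) ∂m ∂m := sg_swap (by fun_prop)
    _ = ∫ y, (R : 𝕜) * (φ y * ((h y : ℝ) : 𝕜)) ∂m := by
        congr 1; ext y
        have : ∀ x, φ y * ((P (x, y) : ℝ) : 𝕜) * ((h x : ℝ) : 𝕜) = φ y * ((h x * P (x, y) : ℝ) : 𝕜) := by
          intro x; push_cast; ring
        simp_rw [this]
        rw [integral_const_mul, integral_ofReal, heig]
        push_cast; ring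
    _ = _ := integral_const_mul _ _

lemma sg_eig_orth {𝕜 : Type*} [RCLike 𝕜] (P : C(X × X, ℝ)) (R : ℝ) (h : C(X, ℝ))
    (heig : ∀ y, ∫ x, h x * P (x, y) ∂m = R * h y) (φ : C(X, 𝕜)) (l : 𝕜)
    (hφ : ∀ x, ∫ y, φ y * ((P (x, y) : ℝ) : 𝕜) ∂m = l * φ x) (hl : l ≠ (R : 𝕜)) :
    ∫ x, φ x * ((h x : ℝ) : 𝕜) ∂m = 0 := by
  have h1 := sg_pair P R h heig φ
  simp_rw [hφ, mul_assoc] at h1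
  rw [integral_const_mul] at h1
  have : (l - (R : 𝕜)) * ∫ x, φ x * ((h x : ℝ) : 𝕜) ∂m = 0 := by linear_combination h1
  exact (mul_eq_zero.1 this).resolve_left (sub_ne_zero.2 hl)

lemma sg_eig [m.IsOpenPosMeasure] {𝕜 : Type*} [RCLike 𝕜] (P : C(X × X, ℝ)) (hP : ∀ p, 0 ≤ P p)
    (U : Set X) (hUd : Dense U) (hpos : ∀ x ∈ U, ∀ y ∈ U, 0 < P (x, y)) (R : ℝ) (hR : 0 < R)
    (h : C(X, ℝ)) (h0 : ∀ x, 0 ≤ h x) (hU : ∀ x ∈ U, 0 < h x)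
    (heig : ∀ y, ∫ x, h x * P (x, y) ∂m = R * h y) (φ : C(X, 𝕜)) (hφ0 : φ ≠ 0) (l : 𝕜)
    (hφ : ∀ x, ∫ y, φ y * ((P (x, y) : ℝ) : 𝕜) ∂m = l * φ x) :
    ‖l‖ ≤ R ∧ (‖l‖ = R → l = (R : 𝕜) ∧ ∫ x, φ x * ((h x : ℝ) : 𝕜) ∂m ≠ 0) := by
  have hex : ∃ z ∈ U, φ z ≠ 0 := by
    by_contra! hcon
    apply hφ0
    have : (φ : X → 𝕜) = fun _ => 0 := Continuous.ext_on hUd φ.continuous continuous_const hcon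
    ext z
    exact congrFun this z
  obtain ⟨z, hz, hφz⟩ := hex
  let a : C(X, ℝ) := ⟨fun x => ‖φ x‖, by fun_prop⟩
  have ha : ∀ x, a x = ‖φ x‖ := fun x => rfl
  let N : C(X, ℝ) := sgOp m P a
  have hN : ∀ x, N x = ∫ y, a y * P (x, y) ∂m := fun x => rfl
  have hle : ∀ x, ‖l‖ * a x ≤ N x := by
    intro x
    rw [ha, ← norm_mul, ← hφ x, hN]
    refine (norm_integral_le_integral_norm _).trans_eq ?_
    congr 1; ext y
    rw [norm_mul, RCLike.norm_ofReal, abs_of_nonneg (hP _), ha]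
  have hpair : ∫ x, N x * h x ∂m = R * ∫ x, a x * h x ∂m := by
    have := sg_pair (𝕜 := ℝ) P R h heig a
    simp only [RCLike.ofReal_real_eq_id, id_eq] at this
    simp_rw [hN]
    exact this
  have hIpos : 0 < ∫ x, a x * h x ∂m :=
    sg_pos (x₀ := z) (by fun_prop) (fun x => mul_nonneg (norm_nonneg (φ x)) (h0 x))
      (mul_ne_zero (norm_ne_zero_iff.2 hφz) (hU z hz).ne')
  have hdiff : ∫ x, (N x - ‖l‖ * a x) * h x ∂m = (R - ‖l‖) * ∫ x, a x * h x ∂m := by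
    rw [sub_mul, ← hpair, ← integral_const_mul,
      ← integral_sub (sg_integrable (by fun_prop)) (sg_integrable (by fun_prop))]
    congr 1; ext x; ring
  have hdn : ∀ x, 0 ≤ (N x - ‖l‖ * a x) * h x := fun x => mul_nonneg (sub_nonneg.2 (hle x)) (h0 x)
  have hnn : 0 ≤ (R - ‖l‖) * ∫ x, a x * h x ∂m := by
    rw [← hdiff]; exact integral_nonneg hdn
  refine ⟨sub_nonneg.1 (nonneg_of_mul_nonneg_left hnn hIpos), fun hlR => ?_⟩
  have hNU : ∀ x ∈ U, N x = ‖l‖ * a x := by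
    intro x hx
    have := sg_zero (m := m) (f := fun x => (N x - ‖l‖ * a x) * h x) (by fun_prop) hdn
      (by rw [hdiff, hlR]; simp) x
    exact sub_eq_zero.1 ((mul_eq_zero.1 this).resolve_right (hU x hx).ne')
  have hlne : l ≠ 0 := by
    rw [← norm_ne_zero_iff, hlR]; exact hR.ne'
  obtain ⟨w, hw1, hw⟩ : ∃ w : 𝕜, ‖w‖ = 1 ∧ w * (l * φ z) = ((‖l * φ z‖ : ℝ) : 𝕜) := by
    have hne : l * φ z ≠ 0 := mul_ne_zero hlne hφz
    have hne' : ((‖l * φ z‖ : ℝ) : 𝕜) ≠ 0 := by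
      rw [Ne, RCLike.ofReal_eq_zero]; exact norm_ne_zero_iff.2 hne
    refine ⟨((‖l * φ z‖ : ℝ) : 𝕜) / (l * φ z), ?_, div_mul_cancel₀ _ hne⟩
    rw [norm_div, RCLike.norm_ofReal, abs_norm, div_self (norm_ne_zero_iff.2 hne)]
  have hre_le : ∀ y, RCLike.re (w * φ y) ≤ a y := fun y => by
    have := RCLike.re_le_norm (w * φ y)
    rwa [norm_mul, hw1, one_mul] at this
  have hIz : ∫ y, (a y - RCLike.re (w * φ y)) * P (z, y) ∂m = 0 := by
    have h1 : ∫ y, RCLike.re (w * φ y) * P (z, y) ∂m = ‖l‖ * a z := by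
      have : ∀ y, RCLike.re (w * φ y) * P (z, y) = RCLike.re (w * (φ y * ((P (z, y) : ℝ) : 𝕜))) := by
        intro y
        rw [← mul_assoc, mul_comm _ ((P (z, y) : ℝ) : 𝕜), RCLike.re_ofReal_mul, mul_comm]
      simp_rw [this]
      rw [integral_re (sg_integrable (by fun_prop)), integral_const_mul, hφ, hw, RCLike.ofReal_re, norm_mul, ha]
    simp_rw [sub_mul]
    rw [integral_sub (sg_integrable (by fun_prop)) (sg_integrable (by fun_prop)), h1, ← hN, hNU z hz, sub_self]
  have hphU : ∀ y ∈ U, RCLike.re (w * φ y) = a y := by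
    intro y hy
    have := sg_zero (m := m) (f := fun y => (a y - RCLike.re (w * φ y)) * P (z, y)) (by fun_prop)
      (fun y => mul_nonneg (sub_nonneg.2 (hre_le y)) (hP _)) hIz y
    exact (sub_eq_zero.1 ((mul_eq_zero.1 this).resolve_right (hpos z hz y hy).ne')).symm
  have hph : ∀ y, w * φ y = ((a y : ℝ) : 𝕜) := by
    have h1 : (fun y => w * φ y) = fun y => ((a y : ℝ) : 𝕜) := by
      refine Continuous.ext_on hUd (by fun_prop) (by fun_prop) fun y hy => ?_
      have h2 := hphU y hy
      have h3 : ‖w * φ y‖ = a y := by rw [norm_mul, hw1, one_mul, ha]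
      have h4 : RCLike.re (w * φ y) = ‖w * φ y‖ := by rw [h2, h3]
      have h5 := RCLike.re_eq_self_of_le h4.ge
      rw [h2] at h5
      exact h5.symm
    exact fun y => congrFun h1 y
  constructor
  · have h1 : w * (l * φ z) = ((N z : ℝ) : 𝕜) := by
      rw [hN, ← hφ, ← integral_const_mul, ← integral_ofReal]
      congr 1; ext y
      rw [← mul_assoc, hph]; push_cast; rfl
    have h2 : l * ((a z : ℝ) : 𝕜) = (R : 𝕜) * ((a z : ℝ) : 𝕜) := by
      rw [← RCLike.ofReal_mul, ← hlR, ← hNU z hz, ← h1, ← hph]; ring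
    refine mul_right_cancel₀ ?_ h2
    rw [Ne, RCLike.ofReal_eq_zero]
    exact norm_ne_zero_iff.2 hφz
  · intro hcon
    have h1 : w * ∫ x, φ x * ((h x : ℝ) : 𝕜) ∂m = ((∫ x, a x * h x ∂m : ℝ) : 𝕜) := by
      rw [← integral_const_mul, ← integral_ofReal]
      congr 1; ext y
      rw [← mul_assoc, hph]; push_cast; rfl
    rw [hcon, mul_zero] at h1
    exact hIpos.ne' (RCLike.ofReal_eq_zero.1 h1.symm)

lemma sg_isCompactOperator {𝕜 : Type*} [RCLike 𝕜] (P : C(X × X, ℝ)) (T : C(X, 𝕜) →L[𝕜] C(X, 𝕜))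
    (hT : ∀ (β : C(X, 𝕜)) (x : X), T β x = ∫ y, β y * ((P (x, y) : ℝ) : 𝕜) ∂m) :
    IsCompactOperator T := by
  obtain ⟨A, hA, h⟩ := sg_compact m 𝕜 P 1
  refine (isCompactOperator_iff_image_closedBall_subset_compact (T : C(X, 𝕜) →ₗ[𝕜] C(X, 𝕜)) one_pos).2
    ⟨A, hA, ?_⟩
  rintro _ ⟨g, hg, rfl⟩
  exact h _ g (by simpa using hg) (hT g)

theorem sg_main [Nonempty X] [m.IsOpenPosMeasure] (P : C(X × X, ℝ)) (hP : ∀ p, 0 ≤ P p)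
    (U : Set X) (hUo : IsOpen U) (hUd : Dense U) (hpos : ∀ x ∈ U, ∀ y ∈ U, 0 < P (x, y))
    (T : C(X, ℝ) →L[ℝ] C(X, ℝ))
    (hT : ∀ (β : C(X, ℝ)) (x : X), T β x = ∫ y, β y * P (x, y) ∂m)
    (TC : C(X, ℂ) →L[ℂ] C(X, ℂ))
    (hTC : ∀ (β : C(X, ℂ)) (x : X), TC β x = ∫ y, β y * (P (x, y) : ℂ) ∂m) :
    ∃ ρ : ℝ, 0 ≤ ρ ∧ ρ < (spectralRadius ℝ T).toReal ∧
      ∀ l : ℂ, (∃ φ : C(X, ℂ), φ ≠ 0 ∧ TC φ = l • φ) →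
        l ≠ ((spectralRadius ℝ T).toReal : ℂ) → ‖l‖ ≤ ρ := by
  obtain ⟨R, hR, h, h0, hU, heig⟩ := sg_left (m := m) P hP U hUo hUd hpos
  have hT' : ∀ (β : C(X, ℝ)) (x : X), T β x = ∫ y, β y * ((P (x, y) : ℝ) : ℝ) ∂m := hT
  have hrad : (spectralRadius ℝ T).toReal = R := by
    have hsp : spectralRadius ℝ T = ENNReal.ofReal R := by
      apply le_antisymm
      · refine iSup₂_le fun k hk => ?_
        have hkR : ‖k‖ ≤ R := by
          by_cases hk0 : k = 0
          · rw [hk0, norm_zero]; exact hR.le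
          have hev := ((sg_isCompactOperator P T hT').hasEigenvalue_iff_mem_spectrum hk0).2 hk
          obtain ⟨v, hv⟩ := hev.exists_hasEigenvector
          refine (sg_eig (m := m) (𝕜 := ℝ) P hP U hUd hpos R hR h h0 hU heig v hv.2 k fun x => ?_).1
          have := hv.apply_eq_smul
          have h2 : T v x = (k • v) x := congrArg (fun f : C(X, ℝ) => f x) this
          exact (hT' v x).symm.trans h2
        have h3 := ENNReal.ofReal_le_ofReal hkR
        rw [ofReal_norm k] at h3
        exact h3
      · have hmem : R ∈ spectrum ℝ T := by
          rw [spectrum.mem_iff]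
          intro hunit
          obtain ⟨f, hf⟩ := ((ContinuousLinearMap.isUnit_iff_bijective).1 hunit).2 h
          have h1 := sg_pair (m := m) (𝕜 := ℝ) P R h heig f
          have h2 : ∀ x, ∫ y, f y * P (x, y) ∂m = R * f x - h x := by
            intro x
            rw [← hT]
            have : R * f x - T f x = h x := congrArg (fun f : C(X, ℝ) => f x) hf
            linarith
          simp only [RCLike.ofReal_real_eq_id, id_eq] at h1
          simp_rw [h2, sub_mul, mul_assoc] at h1
          rw [integral_sub (sg_integrable (by fun_prop)) (sg_integrable (by fun_prop)),
            integral_const_mul] at h1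
          obtain ⟨x₀, hx₀⟩ := hUd.nonempty
          have h3 : 0 < ∫ x, h x * h x ∂m := sg_pos (x₀ := x₀) (by fun_prop)
            (fun x => mul_self_nonneg _) (mul_pos (hU _ hx₀) (hU _ hx₀)).ne'
          linarith
        have := le_iSup₂ (f := fun (k : ℝ) (_ : k ∈ spectrum ℝ T) => (‖k‖₊ : ENNReal)) R hmem
        refine le_trans ?_ this
        rw [← Real.enorm_of_nonneg hR.le]
        rfl
    rw [hsp, ENNReal.toReal_ofReal hR.le]
  rw [hrad]
  by_contra! hcon
  have hseq : ∀ n : ℕ, ∃ l : ℂ, ∃ φ : C(X, ℂ), ‖φ‖ = 1 ∧ TC φ = l • φ ∧ l ≠ (R : ℂ) ∧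
      R - 1 / ((n : ℝ) + 1) ≤ ‖l‖ := by
    intro n
    have hp : (0 : ℝ) < 1 / ((n : ℝ) + 1) := by positivity
    obtain ⟨l, ⟨φ, hφ0, hφ⟩, hl, hlt⟩ := hcon (max 0 (R - 1 / ((n : ℝ) + 1))) (le_max_left _ _)
      (max_lt hR (by linarith))
    refine ⟨l, ((‖φ‖ : ℂ))⁻¹ • φ, ?_, ?_, hl, (le_max_right _ _).trans hlt.le⟩
    · rw [norm_smul, norm_inv, Complex.norm_real, norm_norm, inv_mul_cancel₀ (norm_ne_zero_iff.2 hφ0)]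
    · rw [map_smul, hφ, smul_comm]
  choose l φ hn hev hlne hlb using hseq
  have hne : ∀ n, φ n ≠ 0 := fun n => by
    rw [← norm_ne_zero_iff, hn]; exact one_ne_zero
  have hIntEq : ∀ n x, ∫ y, φ n y * ((P (x, y) : ℝ) : ℂ) ∂m = l n * φ n x := by
    intro n x
    rw [← hTC, hev]; rfl
  have hub : ∀ n, ‖l n‖ ≤ R := fun n =>
    (sg_eig (m := m) (𝕜 := ℂ) P hP U hUd hpos R hR h h0 hU heig (φ n) (hne n) (l n) (hIntEq n)).1
  obtain ⟨A, hA, hAm⟩ := sg_compact m ℂ P 1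
  have hAm' : ∀ n, (l n, TC (φ n)) ∈ Metric.closedBall (0 : ℂ) R ×ˢ A := fun n =>
    ⟨by simpa using hub n, hAm _ (φ n) (hn n).le (hTC _)⟩
  obtain ⟨⟨l', f⟩, -, s, hs, hlim⟩ := ((isCompact_closedBall (0 : ℂ) R).prod hA).tendsto_subseq hAm'
  have hl : Tendsto (fun n => l (s n)) atTop (𝓝 l') := (continuous_fst.tendsto _).comp hlim
  have hf : Tendsto (fun n => TC (φ (s n))) atTop (𝓝 f) := (continuous_snd.tendsto _).comp hlim
  have hnl : ‖l'‖ = R := by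
    have h1 : Tendsto (fun n => ‖l n‖) atTop (𝓝 R) := by
      refine tendsto_of_tendsto_of_tendsto_of_le_of_le ?_ tendsto_const_nhds hlb hub
      simpa using (tendsto_const_nhds (x := R)).sub (tendsto_one_div_add_atTop_nhds_zero_nat (𝕜 := ℝ))
    exact tendsto_nhds_unique hl.norm (h1.comp hs.tendsto_atTop)
  have hl'0 : l' ≠ 0 := by
    rw [← norm_ne_zero_iff, hnl]; exact hR.ne'
  have hφlim : Tendsto (fun n => φ (s n)) atTop (𝓝 (l'⁻¹ • f)) := by
    refine ((hl.inv₀ hl'0).smul hf).congr' ?_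
    filter_upwards [hl.eventually_ne hl'0] with n hn0
    rw [hev, smul_smul, inv_mul_cancel₀ hn0, one_smul]
  set ψ : C(X, ℂ) := l'⁻¹ • f with hψ
  have hψn : ‖ψ‖ = 1 := tendsto_nhds_unique hφlim.norm (by simp [hn])
  have hψ0 : ψ ≠ 0 := by
    rw [← norm_ne_zero_iff, hψn]; exact one_ne_zero
  have hψev : TC ψ = l' • ψ := by
    refine tendsto_nhds_unique ((TC.continuous.tendsto ψ).comp hφlim) ?_
    refine (hl.smul hφlim).congr fun n => ?_
    exact (hev _).symm
  have hfin := (sg_eig (m := m) (𝕜 := ℂ) P hP U hUd hpos R hR h h0 hU heig ψ hψ0 l'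
    (fun x => (hTC ψ x).symm.trans (congrArg (fun f : C(X, ℂ) => f x) hψev))).2 hnl
  apply hfin.2
  have horth : ∀ n, ∫ x, φ n x * ((h x : ℝ) : ℂ) ∂m = 0 := fun n =>
    sg_eig_orth (m := m) (𝕜 := ℂ) P R h heig (φ n) (l n) (hIntEq n) (hlne n)
  have hI : Tendsto (fun n => ∫ x, φ (s n) x * ((h x : ℝ) : ℂ) ∂m) atTop
      (𝓝 (∫ x, ψ x * ((h x : ℝ) : ℂ) ∂m)) := by
    refine tendsto_integral_of_dominated_convergence (fun _ => ‖h‖)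
      (fun n => (sg_integrable (m := m) (by fun_prop)).aestronglyMeasurable)
      (integrable_const _) (fun n => Eventually.of_forall fun x => ?_)
      (Eventually.of_forall fun x => ?_)
    · rw [norm_mul, Complex.norm_real]
      have h1 := (φ (s n)).norm_coe_le_norm x
      rw [hn] at h1
      have h2 := h.norm_coe_le_norm x
      nlinarith [norm_nonneg (h x)]
    · exact (((continuous_eval_const x).tendsto ψ).comp hφlim).mul_const _
  refine tendsto_nhds_unique hI ?_
  simp_rw [horth]
  exact tendsto_const_nhds

end Abstract

/-- The integral operator `T` has a nonzero spectral gap: every eigenvalue of `T_ℂ` other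
than the spectral radius `r` of `T` has modulus at most some `ρ < r`. -/
theorem stmt_6 {d : ℕ} (K : Set (EuclideanSpace ℝ (Fin d)))
    [Nonempty ↥K] [CompactSpace ↥K]
    (hKint : (interior K).Nonempty) (hKreg : K = closure (interior K))
    (P : ↥K × ↥K → ℝ) (hPcont : Continuous P)
    (hPnonneg : ∀ x y : ↥K, 0 ≤ P (x, y))
    (hPpos : ∀ x y : ↥K, (x : EuclideanSpace ℝ (Fin d)) ∈ interior K →
      (y : EuclideanSpace ℝ (Fin d)) ∈ interior K → 0 < P (x, y))
    (hPsub : ∀ x : ↥K, ∫ y : ↥K, P (x, y) ∂(lebOn K) ≤ 1)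
    (T : C(↥K, ℝ) →L[ℝ] C(↥K, ℝ))
    (hT : ∀ (β : C(↥K, ℝ)) (x : ↥K), T β x = ∫ y : ↥K, β y * P (x, y) ∂(lebOn K))
    (TC : C(↥K, ℂ) →L[ℂ] C(↥K, ℂ))
    (hTC : ∀ (β : C(↥K, ℂ)) (x : ↥K),
      TC β x = ∫ y : ↥K, β y * (P (x, y) : ℂ) ∂(lebOn K)) :
    ∃ ρ : ℝ, 0 ≤ ρ ∧ ρ < (spectralRadius ℝ T).toReal ∧
      ∀ l : ℂ, (∃ φ : C(↥K, ℂ), φ ≠ 0 ∧ TC φ = l • φ) →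
        l ≠ ((spectralRadius ℝ T).toReal : ℂ) → ‖l‖ ≤ ρ := by
  have hKc : IsCompact K := isCompact_iff_compactSpace.2 inferInstance
  have hKm : MeasurableSet K := hKc.isClosed.measurableSet
  have hemb : MeasurableEmbedding (Subtype.val : ↥K → EuclideanSpace ℝ (Fin d)) :=
    MeasurableEmbedding.subtype_coe hKm
  have : IsFiniteMeasure (lebOn K) := by
    refine ⟨?_⟩
    rw [lebOn, hemb.comap_apply]
    refine lt_of_le_of_lt (measure_mono ?_) hKc.measure_lt_top
    rintro _ ⟨x, -, rfl⟩
    exact x.2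
  let U : Set ↥K := Subtype.val ⁻¹' interior K
  have hUo : IsOpen U := isOpen_interior.preimage continuous_subtype_val
  have hmeet : ∀ V : Set (EuclideanSpace ℝ (Fin d)), IsOpen V → (∃ x ∈ K, x ∈ V) →
      (V ∩ interior K).Nonempty := by
    rintro V hV ⟨x, hx, hxV⟩
    rw [hKreg] at hx
    exact mem_closure_iff.1 hx V hV hxV
  have hUd : Dense U := by
    rw [dense_iff_inter_open]
    rintro W hW ⟨x, hx⟩
    obtain ⟨V, hV, rfl⟩ := isOpen_induced_iff.1 hW
    obtain ⟨z, hzV, hzK⟩ := hmeet V hV ⟨x, x.2, hx⟩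
    exact ⟨⟨z, interior_subset hzK⟩, hzV, hzK⟩
  have : (lebOn K).IsOpenPosMeasure := by
    refine ⟨?_⟩
    rintro W hW ⟨x, hx⟩
    obtain ⟨V, hV, rfl⟩ := isOpen_induced_iff.1 hW
    have hne := hmeet V hV ⟨x, x.2, hx⟩
    have hp := (hV.inter (isOpen_interior (s := K))).measure_pos volume hne
    rw [lebOn, hemb.comap_apply]
    refine (hp.trans_le (measure_mono ?_)).ne'
    rintro z ⟨hzV, hzK⟩
    exact ⟨⟨z, interior_subset hzK⟩, hzV, rfl⟩
  exact sg_main (m := lebOn K) ⟨P, hPcont⟩ (fun p => hPnonneg p.1 p.2) U hUo hUd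
    (fun x hx y hy => hPpos x y hx hy) T hT TC hTC
end
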